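/- arXiv:2310.00281 — 5 statements merged into one kernel-verified Lean document; each statement's English description precedes it below -/
import Mathlib

section
/- Let p ≥ 2 be a real number. There exists a constant c₂ > 0 depending only on p such that for all real numbers 0 < a < b and every measurable function f : ℝ → ℝ with f(x) ≥ 0 for x ∈ (a,b) and ∫_a^b f(x)^p dx < ∞, one has ∫_a^b ((1/x) ∫_a^x f(t) dt)^p dx ≤ (p/(p-1))^p (1 + c₂ / (ln(b/a))²)^{-1} ∫_a^b f(x)^p dx. -/
open Real MeasureTheory intervalIntegral

theorem ContDiff.comp_absolutelyContinuousOnInterval {f g : ℝ → ℝ} {a b : ℝ}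
    (hg : ContDiff ℝ 1 g) (hf : AbsolutelyContinuousOnInterval f a b) :
    AbsolutelyContinuousOnInterval (fun x => g (f x)) a b := by
  obtain ⟨C, hC⟩ := hf.exists_bound
  obtain ⟨K, hK⟩ := hg.contDiffOn.exists_lipschitzOnWith (by decide)
    (convex_Icc (-C) C) isCompact_Icc
  have hmem : ∀ x ∈ Set.uIcc a b, f x ∈ Set.Icc (-C) C := fun x hx => abs_le.1 (hC x hx)
  rw [absolutelyContinuousOnInterval_iff] at hf ⊢
  intro ε hε
  obtain ⟨δ, hδ, h⟩ := hf (ε / (K + 1)) (by positivity)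
  refine ⟨δ, hδ, fun E hE hlt => ?_⟩
  calc ∑ i ∈ Finset.range E.1, Dist.dist (g (f (E.2 i).1)) (g (f (E.2 i).2))
      ≤ ∑ i ∈ Finset.range E.1, (K + 1) * Dist.dist (f (E.2 i).1) (f (E.2 i).2) := by
        refine Finset.sum_le_sum fun i hi => ?_
        refine (hK.dist_le_mul _ (hmem _ (hE.1 i hi).1) _ (hmem _ (hE.1 i hi).2)).trans ?_
        gcongr
        linarith
    _ = (K + 1) * ∑ i ∈ Finset.range E.1, Dist.dist (f (E.2 i).1) (f (E.2 i).2) :=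
        (Finset.mul_sum _ _ _).symm
    _ < (K + 1) * (ε / (K + 1)) := by
        gcongr
        exact h E hE hlt
    _ = ε := by field

theorem intervalIntegrable_of_rpow {f : ℝ → ℝ} {p a b : ℝ} (hp : 1 ≤ p) (hab : a ≤ b)
    (hf : Measurable f) (hf0 : ∀ x ∈ Set.Ioo a b, 0 ≤ f x)
    (hfp : IntervalIntegrable (fun x => f x ^ p) volume a b) :
    IntervalIntegrable f volume a b := by
  rw [intervalIntegrable_iff_integrableOn_Ioo_of_le hab] at hfp ⊢
  refine Integrable.mono' (g := fun x => 1 + f x ^ p) ((integrable_const _).add hfp)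
    hf.aestronglyMeasurable ?_
  filter_upwards [ae_restrict_mem measurableSet_Ioo] with x hx
  have h0 := hf0 x hx
  rw [norm_eq_abs, abs_of_nonneg h0]
  rcases le_total (f x) 1 with h | h
  · linarith [rpow_nonneg h0 p]
  · linarith [self_le_rpow_of_one_le h hp]

/-- The Riccati-type inequality satisfied by the logarithmic perturbation `u = 1 + r` of the
extremal weight. -/
theorem riccati_lower_bound {p L r : ℝ} (hp : 2 ≤ p) (hL : 0 < L) (hr : 0 ≤ r)
    (hrL : r ≤ ((p - 1) ^ 2)⁻¹ / L) :
    1 + (p - 1)⁻¹ / L ^ 2 ≤ p * (1 + r) ^ (p - 1) - (p - 1) * (1 + r) ^ p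
      + p * (((p - 1) ^ 2)⁻¹ / L ^ 2) * (1 + r) ^ (p - 2) := by
  obtain ⟨k, rfl⟩ : ∃ k, p = k + 1 := ⟨p - 1, by ring⟩
  have hk : 1 ≤ k := by linarith
  simp only [add_sub_cancel_right] at *
  obtain ⟨z, hz, rfl⟩ : ∃ z, 0 < z ∧ L = z⁻¹ := ⟨L⁻¹, by positivity, by simp⟩
  have hu : 0 < 1 + r := by linarith
  have e1 : (1 + r) ^ (k + 1) = (1 + r) ^ k * (1 + r) := rpow_add_one hu.ne' k
  have e2 : (1 + r) ^ (k + 1 - 2) = (1 + r) ^ k / (1 + r) := by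
    rw [← rpow_sub_one hu.ne']; congr 1; ring
  have hbern : 1 + k * r ≤ (1 + r) ^ k := one_add_mul_self_le_rpow_one_add (by linarith) hk
  have hrz : k ^ 2 * r ≤ z := by
    rw [div_inv_eq_mul, inv_mul_eq_div, le_div_iff₀ (by positivity)] at hrL
    linarith
  rw [e1, e2]
  set A := (1 + r) ^ k
  have hB : 0 ≤ (1 + r) * (1 - k * r) + (k + 1) * (z / k) ^ 2 := by
    have hw : k * r ≤ z / k := by
      rw [le_div_iff₀ (by positivity)]; linarith
    set w := z / k
    have : 0 ≤ k * r := by positivity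
    nlinarith [sq_nonneg (w - 1), mul_nonneg (sub_nonneg.2 hk) hr]
  have hkey : 1 + k⁻¹ * z ^ 2 ≤
      (1 + k * r) * (((1 + r) * (1 - k * r) + (k + 1) * (z / k) ^ 2) / (1 + r)) := by
    have h1 : (k * r) ^ 2 ≤ (z / k) ^ 2 := by
      gcongr
      rw [le_div_iff₀ (by positivity)]; linarith
    have h2 : (k + 1) * (z / k) ^ 2 ≤ (1 + k * r) / (1 + r) * ((k + 1) * (z / k) ^ 2) := by
      refine le_mul_of_one_le_left (by positivity) ?_
      rw [one_le_div hu]; nlinarith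
    have h3 : k⁻¹ * z ^ 2 = k * (z / k) ^ 2 := by field
    have h4 : (1 + k * r) * (((1 + r) * (1 - k * r) + (k + 1) * (z / k) ^ 2) / (1 + r))
        = (1 - (k * r) ^ 2) + (1 + k * r) / (1 + r) * ((k + 1) * (z / k) ^ 2) := by
      field
    rw [h4, h3]
    linarith
  calc 1 + k⁻¹ / z⁻¹ ^ 2 = 1 + k⁻¹ * z ^ 2 := by field
    _ ≤ _ := hkey
    _ ≤ A * (((1 + r) * (1 - k * r) + (k + 1) * (z / k) ^ 2) / (1 + r)) := by gcongr
    _ = _ := by field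

theorem young_rpow_sub_one {p y s : ℝ} (hp : 1 < p) (hy : 0 ≤ y) (hs : 0 ≤ s) :
    p * (p / (p - 1)) * y * s ^ (p - 1) ≤ (p / (p - 1)) ^ p * y ^ p + (p - 1) * s ^ p := by
  have hp1 : 0 < p - 1 := by linarith
  have h := young_inequality_of_nonneg (a := p / (p - 1) * y) (b := s ^ (p - 1))
    (by positivity) (by positivity) (Real.HolderConjugate.conjExponent hp)
  rw [conjExponent, mul_rpow (by positivity) hy, ← rpow_mul hs, mul_div_cancel₀ _ hp1.ne'] at h
  calc _ = p * (p / (p - 1) * y * s ^ (p - 1)) := by ring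
    _ ≤ p * ((p / (p - 1)) ^ p * y ^ p / p + s ^ p / (p / (p - 1))) := by gcongr
    _ = _ := by field

/-- The calibrating weight `(1 + m log (b / x)) ^ (p - 1) * x ^ (1 - p)`. -/
noncomputable def hardyWeight (p m b x : ℝ) : ℝ :=
  (1 + m * (log b - log x)) ^ (p - 1) * x ^ (1 - p)

theorem hasDerivAt_hardyWeight {p m b x : ℝ} (hx : 0 < x) (hu : 0 < 1 + m * (log b - log x)) :
    HasDerivAt (hardyWeight p m b)
      (-(p - 1) * x ^ (-p) * (m * (1 + m * (log b - log x)) ^ (p - 2)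
        + (1 + m * (log b - log x)) ^ (p - 1))) x := by
  have h1 : HasDerivAt (fun x => 1 + m * (log b - log x)) (m * (-x⁻¹)) x :=
    (((hasDerivAt_log hx.ne').const_sub _).const_mul m).const_add 1
  have h := (h1.rpow_const (p := p - 1) (Or.inl hu.ne')).mul
    (hasDerivAt_rpow_const (x := x) (p := 1 - p) (Or.inl hx.ne'))
  refine h.congr_deriv ?_
  have e1 : x ^ (1 - p) = x * x ^ (-p) := by
    rw [sub_eq_add_neg, rpow_add hx, rpow_one]
  rw [e1, show p - 1 - 1 = p - 2 by ring, show 1 - p - 1 = -p by ring]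
  field

theorem hardy_pointwise {p L m b x y F : ℝ} (hp : 2 ≤ p) (hL : 0 < L)
    (hm : m = ((p - 1) ^ 2)⁻¹ / L ^ 2) (hx : 0 < x) (hr : 0 ≤ log b - log x)
    (hrL : log b - log x ≤ L) (hy : 0 ≤ y) (hF : 0 ≤ F) :
    (1 + (p - 1)⁻¹ / L ^ 2) * (1 / x * F) ^ p + p / (p - 1) *
      (y * p * F ^ (p - 1) * hardyWeight p m b x + F ^ p * deriv (hardyWeight p m b) x)
      ≤ (p / (p - 1)) ^ p * y ^ p := by
  have hp1 : 0 < p - 1 := by linarith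
  have hm0 : 0 ≤ m := by rw [hm]; positivity
  have hr0 : 0 ≤ m * (log b - log x) := by positivity
  have hu : 0 < 1 + m * (log b - log x) := by positivity
  have hric := riccati_lower_bound hp hL hr0 (by
    calc m * (log b - log x) ≤ m * L := by gcongr
      _ = _ := by rw [hm]; field)
  rw [(hasDerivAt_hardyWeight hx hu).deriv, hardyWeight]
  rw [← hm] at hric
  set u := 1 + m * (log b - log x)
  have hyoung := young_rpow_sub_one (p := p) (by linarith) hy
    (show 0 ≤ F * u * x⁻¹ by positivity)
  rw [mul_rpow (by positivity) (by positivity), mul_rpow hF hu.le, mul_rpow (by positivity)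
    (by positivity), mul_rpow hF hu.le, inv_rpow hx.le, inv_rpow hx.le, ← rpow_neg hx.le,
    ← rpow_neg hx.le, neg_sub] at hyoung
  rw [mul_rpow (by positivity) hF, one_div, inv_rpow hx.le, ← rpow_neg hx.le]
  have hmul := mul_le_mul_of_nonneg_left hric (show 0 ≤ x ^ (-p) * F ^ p by positivity)
  have e : p / (p - 1) * (y * p * F ^ (p - 1) * (u ^ (p - 1) * x ^ (1 - p)) + F ^ p *
      (-(p - 1) * x ^ (-p) * (m * u ^ (p - 2) + u ^ (p - 1))))
      = p * (p / (p - 1)) * y * (F ^ (p - 1) * u ^ (p - 1) * x ^ (1 - p))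
        - x ^ (-p) * F ^ p * (p * u ^ (p - 1) + p * m * u ^ (p - 2)) := by
    field
  rw [e]
  linarith

/-- Upper estimate for the constant in the finite-interval Hardy inequality:
d(a,b) ≤ (p/(p-1))^p (1 + c₂/ln²(b/a))⁻¹. -/
theorem hardy_finite_interval_upper (p : ℝ) (hp : 2 ≤ p) :
    ∃ c₂ : ℝ, 0 < c₂ ∧ ∀ a b : ℝ, 0 < a → a < b → ∀ f : ℝ → ℝ, Measurable f →
      (∀ x ∈ Set.Ioo a b, 0 ≤ f x) →
      IntervalIntegrable (fun x => f x ^ p) MeasureTheory.volume a b →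
      ∫ x in a..b, ((1 / x) * ∫ t in a..x, f t) ^ p
        ≤ (p / (p - 1)) ^ p * (1 + c₂ / (Real.log (b / a)) ^ 2)⁻¹ *
            ∫ x in a..b, f x ^ p := by
  have hp1 : 0 < p - 1 := by linarith
  refine ⟨(p - 1)⁻¹, by positivity, fun a b ha hab f hf hf0 hfp => ?_⟩
  have hb : 0 < b := ha.trans hab
  have hlog : log (b / a) = log b - log a := log_div hb.ne' ha.ne'
  have hL : 0 < log (b / a) := log_pos ((one_lt_div ha).2 hab)
  set L := log (b / a)
  obtain ⟨m, hm⟩ : ∃ m, m = ((p - 1) ^ 2)⁻¹ / L ^ 2 := ⟨_, rfl⟩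
  have hm0 : 0 ≤ m := by rw [hm]; positivity
  have hlogb : ∀ x ∈ Set.Icc a b, 0 < x ∧ 0 ≤ log b - log x ∧ log b - log x ≤ L := by
    intro x hx
    have hx0 := ha.trans_le hx.1
    exact ⟨hx0, sub_nonneg.2 (log_le_log hx0 hx.2), by
      rw [hlog]; linarith [log_le_log ha hx.1]⟩
  have hfi := intervalIntegrable_of_rpow (by linarith) hab.le hf hf0 hfp
  set F : ℝ → ℝ := fun x => ∫ t in a..x, f t with hFdef
  have hF0 : ∀ x ∈ Set.Icc a b, 0 ≤ F x := by
    intro x hx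
    simp only [hFdef]
    rw [integral_of_le hx.1, integral_Ioc_eq_integral_Ioo]
    exact setIntegral_nonneg measurableSet_Ioo fun t ht => hf0 t ⟨ht.1, ht.2.trans_le hx.2⟩
  have hFac : AbsolutelyContinuousOnInterval F a b :=
    hfi.absolutelyContinuousOnInterval_intervalIntegral (by simp)
  have hFpac : AbsolutelyContinuousOnInterval (fun x => F x ^ p) a b :=
    (contDiff_rpow_const_of_le (n := 1) (by norm_num; linarith)).comp_absolutelyContinuousOnInterval
      hFac
  have hTac : AbsolutelyContinuousOnInterval (hardyWeight p m b) a b := by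
    refine ContDiffOn.absolutelyContinuousOnInterval ?_
    rw [Set.uIcc_of_le hab.le]
    intro x hx
    obtain ⟨hx0, hr, -⟩ := hlogb x hx
    have hu : 0 < 1 + m * (log b - log x) := by positivity
    refine ContDiffAt.contDiffWithinAt ?_
    unfold hardyWeight
    refine ContDiffAt.mul ?_ (contDiffAt_rpow_const_of_ne hx0.ne')
    exact (contDiffAt_const.add (contDiffAt_const.mul
      (contDiffAt_const.sub (contDiffAt_log.2 hx0.ne')))).rpow_const_of_ne hu.ne'
  have hHac := hFpac.fun_mul hTac
  have hHint := hHac.integral_deriv_eq_sub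
  have hH0 : 0 ≤ ∫ x in a..b, deriv (fun x => F x ^ p * hardyWeight p m b x) x := by
    rw [hHint]
    have hFa : F a = 0 := by simp [hFdef]
    have hTb : 0 ≤ hardyWeight p m b b := by simp [hardyWeight]; positivity
    have := hF0 b ⟨hab.le, le_rfl⟩
    rw [hFa, zero_rpow (by linarith), zero_mul, sub_zero]
    positivity
  have hGint : IntervalIntegrable (fun x => (1 / x * F x) ^ p) volume a b := by
    refine ContinuousOn.intervalIntegrable ?_
    refine ContinuousOn.rpow_const (ContinuousOn.mul ?_ hFac.continuousOn)
      fun x _ => Or.inr (by linarith)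
    refine continuousOn_const.div continuousOn_id fun x hx => ?_
    rw [Set.uIcc_of_le hab.le] at hx
    exact (hlogb x hx).1.ne'
  have hint : (1 + (p - 1)⁻¹ / L ^ 2) * (∫ x in a..b, (1 / x * F x) ^ p)
      + p / (p - 1) * ∫ x in a..b, deriv (fun x => F x ^ p * hardyWeight p m b x) x
      ≤ (p / (p - 1)) ^ p * ∫ x in a..b, f x ^ p := by
    rw [← intervalIntegral.integral_const_mul, ← intervalIntegral.integral_const_mul,
      ← intervalIntegral.integral_const_mul,
      ← intervalIntegral.integral_add (hGint.const_mul _) (hHac.intervalIntegrable_deriv.const_mul _)]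
    refine integral_mono_ae_restrict hab.le ((hGint.const_mul _).add
      (hHac.intervalIntegrable_deriv.const_mul _)) (hfp.const_mul _) ?_
    rw [← restrict_Ioo_eq_restrict_Icc]
    filter_upwards [ae_restrict_mem measurableSet_Ioo,
      ae_restrict_of_ae hfi.ae_hasDerivAt_integral] with x hx hdF
    have hxI := Set.Ioo_subset_Icc_self hx
    obtain ⟨hx0, hr, hrL⟩ := hlogb x hxI
    have hu : 0 < 1 + m * (log b - log x) := by positivity
    have hd := ((hdF (Set.uIcc_of_le hab.le ▸ hxI) a (by simp)).rpow_const (p := p)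
      (Or.inr (by linarith))).mul (hasDerivAt_hardyWeight (p := p) hx0 hu).differentiableAt.hasDerivAt
    have hd' : deriv (fun x => F x ^ p * hardyWeight p m b x) x = _ := hd.deriv
    simp only [hd']
    exact hardy_pointwise hp hL hm hx0 hr hrL (hf0 x hx) (hF0 x hxI)
  have hc : 0 < 1 + (p - 1)⁻¹ / L ^ 2 := by positivity
  have hfin : (1 + (p - 1)⁻¹ / L ^ 2) * (∫ x in a..b, (1 / x * F x) ^ p)
      ≤ (p / (p - 1)) ^ p * ∫ x in a..b, f x ^ p :=
    le_trans (le_add_of_nonneg_right (by positivity)) hint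
  calc _ ≤ ((p / (p - 1)) ^ p * ∫ x in a..b, f x ^ p) / (1 + (p - 1)⁻¹ / L ^ 2) := by
        rw [le_div_iff₀ hc]; linarith
    _ = _ := by ring
end

section
/- Let p ≥ 2 be a real number. There exists a constant c₁ > 0 depending only on p such that for every b > 1 the following holds: if α is a real number in the interval (π/(2 ln b), π/ln b) satisfying tan(α ln b) + α p/(p-1) = 0, and f*(x) = x^{-1/p} ((α p/(p-1)) cos(α ln x) + sin(α ln x)) for 1 ≤ x ≤ b, then ∫_1^b ((1/x) ∫_1^x f*(t) dt)^p dx ≥ (p/(p-1))^p (1 − c₁ / (ln b)²) ∫_1^b f*(x)^p dx. -/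
open Real MeasureTheory intervalIntegral

lemma integral_rpow_mul_cos_log_add_sin_log {p : ℝ} (hp : 1 < p) (α : ℝ) {x : ℝ} (hx : 1 ≤ x) :
    ∫ t in (1:ℝ)..x, t ^ (-(1/p)) * ((α * p / (p - 1)) * Real.cos (α * Real.log t)
      + Real.sin (α * Real.log t)) =
    p / (p - 1) * (x ^ (1 - 1/p) * Real.sin (α * Real.log x)) := by
  have hpos : ∀ t ∈ Set.uIcc 1 x, 0 < t := fun t ht => by
    rw [Set.uIcc_of_le hx] at ht
    linarith [ht.1]
  have hp1 : p - 1 ≠ 0 := by linarith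
  rw [integral_eq_sub_of_hasDerivAt
    (f := fun t => p / (p - 1) * (t ^ (1 - 1/p) * Real.sin (α * Real.log t)))]
  · simp
  · intro t ht
    have h0 := hpos t ht
    have h1 : HasDerivAt (fun t : ℝ => t ^ (1 - 1/p)) _ t :=
      Real.hasDerivAt_rpow_const (Or.inl h0.ne')
    have h2 := ((Real.hasDerivAt_log h0.ne').const_mul α).sin
    refine ((h1.mul h2).const_mul (p / (p - 1))).congr_deriv ?_
    have e1 : t ^ (1 - 1/p) = t ^ (-(1/p)) * t := by
      rw [← Real.rpow_add_one h0.ne']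
      ring_nf
    have e2 : 1 - 1/p - 1 = -(1/p) := by ring
    rw [e1, e2]
    have hp0 : p ≠ 0 := by linarith
    field_simp
    ring
  · apply ContinuousOn.intervalIntegrable
    have hlog : ContinuousOn Real.log (Set.uIcc 1 x) :=
      Real.continuousOn_log.mono fun t ht => (hpos t ht).ne'
    have hrpow : ContinuousOn (fun t : ℝ => t ^ (-(1/p))) (Set.uIcc 1 x) :=
      continuousOn_id.rpow_const fun t ht => Or.inl (hpos t ht).ne'
    fun_prop

lemma rpow_neg_inv_mul_rpow {p x k s : ℝ} (hp : p ≠ 0) (hx : 0 < x) (hk : 0 ≤ k) (hs : 0 ≤ s) :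
    (x ^ (-(1/p)) * (k * s)) ^ p = k ^ p * (s ^ p * x⁻¹) := by
  rw [Real.mul_rpow (by positivity) (by positivity), Real.mul_rpow hk hs, ← Real.rpow_mul hx.le,
    show -(1/p) * p = -1 by field_simp, Real.rpow_neg_one]
  ring

lemma integral_comp_mul_log_mul_inv {G : ℝ → ℝ} (hG : Continuous G) {α b : ℝ} (hα : α ≠ 0)
    (hb : 1 ≤ b) :
    ∫ x in (1:ℝ)..b, G (α * Real.log x) * x⁻¹ = α⁻¹ * ∫ v in (0:ℝ)..α * Real.log b, G v := by
  have hpos : ∀ t ∈ Set.uIcc 1 b, t ≠ 0 := fun t ht => by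
    rw [Set.uIcc_of_le hb] at ht
    linarith [ht.1]
  have h := integral_comp_mul_deriv (a := 1) (b := b) (f := fun x => α * Real.log x)
    (f' := fun x => α * x⁻¹) (g := G)
    (fun x hx => (Real.hasDerivAt_log (hpos x hx)).const_mul α)
    (continuousOn_const.mul (continuousOn_id.inv₀ hpos)) hG
  simp only [Real.log_one, mul_zero] at h
  rw [← h, ← intervalIntegral.integral_const_mul]
  congr 1
  ext x
  simp only [Function.comp]
  field_simp

lemma one_sub_mul_one_add_rpow_le_one {p s t : ℝ} (hp : 0 ≤ p) (hs : 0 ≤ s) (h : p * s ≤ t) :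
    (1 - t) * (1 + s) ^ p ≤ 1 := by
  have h1 : (1 + s) ^ p ≤ Real.exp (s * p) := by
    rw [Real.exp_mul]
    exact Real.rpow_le_rpow (by positivity) (by linarith [Real.add_one_le_exp s]) hp
  have h2 : 1 - t ≤ Real.exp (-t) := by linarith [Real.add_one_le_exp (-t)]
  calc (1 - t) * (1 + s) ^ p ≤ Real.exp (-t) * Real.exp (s * p) := by gcongr
    _ = Real.exp (-t + s * p) := (Real.exp_add _ _).symm
    _ ≤ 1 := Real.exp_le_one_iff.2 (by linarith)

/-- The function f*(x) = x^{-1/p}((αp/(p-1)) cos(α ln x) + sin(α ln x)) is almost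
extremal for the finite-interval Hardy inequality:
∫ ((1/x)∫f*)^p ≥ (p/(p-1))^p (1 - c₁/ln²b) ∫ (f*)^p. -/
theorem hardy_finite_interval_almost_extremal (p : ℝ) (hp : 2 ≤ p) :
    ∃ c₁ : ℝ, 0 < c₁ ∧ ∀ b : ℝ, 1 < b → ∀ α : ℝ,
      α ∈ Set.Ioo (π / (2 * Real.log b)) (π / Real.log b) →
      Real.tan (α * Real.log b) + α * p / (p - 1) = 0 →
      ∫ x in (1:ℝ)..b, ((1 / x) * ∫ t in (1:ℝ)..x,
          t ^ (-(1/p)) * ((α * p / (p - 1)) * Real.cos (α * Real.log t)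
            + Real.sin (α * Real.log t))) ^ p
        ≥ (p / (p - 1)) ^ p * (1 - c₁ / (Real.log b) ^ 2) *
          ∫ x in (1:ℝ)..b,
            (x ^ (-(1/p)) * ((α * p / (p - 1)) * Real.cos (α * Real.log x)
              + Real.sin (α * Real.log x))) ^ p := by
  have hp0 : 0 < p := by linarith
  have hp1 : 0 < p - 1 := by linarith
  set q := p / (p - 1) with hq
  have hq0 : 0 < q := by positivity
  refine ⟨p / 2 * (π * q) ^ 2, by positivity, ?_⟩
  rintro b hb α ⟨hα1, hα2⟩ htan
  have hL : 0 < Real.log b := Real.log_pos hb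
  have hα : 0 < α := lt_trans (by positivity) hα1
  set θ := α * Real.log b with hθ
  have hθ1 : π / 2 < θ := by
    rw [div_lt_iff₀ (by positivity)] at hα1
    linarith
  have hθ2 : θ < π := (lt_div_iff₀ hL).1 hα2
  have hcos : Real.cos θ < 0 := Real.cos_neg_of_pi_div_two_lt_of_lt hθ1 (by linarith)
  have hA : α * p / (p - 1) = -Real.tan θ := by linarith
  have hG : Continuous fun v : ℝ => Real.sin v ^ p :=
    Real.continuous_sin.rpow_const fun _ => Or.inr hp0.le
  have hmem : ∀ x ∈ Set.uIcc 1 b, 1 ≤ x ∧ 0 ≤ α * Real.log x ∧ α * Real.log x ≤ θ := by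
    intro x hx
    rw [Set.uIcc_of_le hb.le] at hx
    refine ⟨hx.1, mul_nonneg hα.le (Real.log_nonneg hx.1), ?_⟩
    have := Real.log_le_log (by linarith [hx.1]) hx.2
    exact mul_le_mul_of_nonneg_left this hα.le
  have hleft : ∫ x in (1:ℝ)..b, ((1 / x) * ∫ t in (1:ℝ)..x,
      t ^ (-(1/p)) * ((α * p / (p - 1)) * Real.cos (α * Real.log t)
        + Real.sin (α * Real.log t))) ^ p
      = q ^ p * (α⁻¹ * ∫ v in (0:ℝ)..θ, Real.sin v ^ p) := by
    rw [← integral_comp_mul_log_mul_inv hG hα.ne' hb.le, ← intervalIntegral.integral_const_mul]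
    refine integral_congr fun x hx => ?_
    obtain ⟨hx1, hv0, hv1⟩ := hmem x hx
    have hx0 : 0 < x := by linarith
    rw [integral_rpow_mul_cos_log_add_sin_log (by linarith) α hx1,
      ← rpow_neg_inv_mul_rpow hp0.ne' hx0 hq0.le
        (Real.sin_nonneg_of_nonneg_of_le_pi hv0 (by linarith))]
    have e1 : x ^ (1 - 1/p) = x ^ (-(1/p)) * x := by
      rw [← Real.rpow_add_one hx0.ne']
      ring_nf
    rw [e1, ← hq]
    congr 1
    field_simp
  have hright : ∫ x in (1:ℝ)..b, (x ^ (-(1/p)) * ((α * p / (p - 1)) * Real.cos (α * Real.log x)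
        + Real.sin (α * Real.log x))) ^ p
      = (-(Real.cos θ)⁻¹) ^ p * (α⁻¹ * ∫ v in (0:ℝ)..θ, Real.sin v ^ p) := by
    have hrefl : ∫ v in (0:ℝ)..θ, Real.sin v ^ p = ∫ v in (0:ℝ)..θ, Real.sin (θ - v) ^ p := by
      rw [integral_comp_sub_left (fun v => Real.sin v ^ p) θ]
      simp
    rw [hrefl, ← integral_comp_mul_log_mul_inv (G := fun v => Real.sin (θ - v) ^ p)
      (hG.comp (continuous_const.sub continuous_id)) hα.ne' hb.le,
      ← intervalIntegral.integral_const_mul]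
    refine integral_congr fun x hx => ?_
    obtain ⟨hx1, hv0, hv1⟩ := hmem x hx
    rw [← rpow_neg_inv_mul_rpow hp0.ne' (by linarith)
        (neg_nonneg.2 (inv_nonpos.2 hcos.le))
        (Real.sin_nonneg_of_nonneg_of_le_pi (by linarith) (by linarith)),
      hA, Real.tan_eq_sin_div_cos, Real.sin_sub]
    congr 2
    have := hcos.ne
    field_simp
    ring
  have hR : (-(Real.cos θ)⁻¹) ^ p = (1 + (α * q) ^ 2) ^ (p / 2) := by
    have hsq : 1 + (α * q) ^ 2 = (-(Real.cos θ)⁻¹) ^ (2:ℝ) := by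
      rw [show α * q = -Real.tan θ by rw [← hA, hq]; ring, Real.rpow_two, neg_sq, neg_sq,
        inv_pow, ← Real.inv_one_add_tan_sq hcos.ne, inv_inv]
    rw [hsq, ← Real.rpow_mul (neg_nonneg.2 (inv_nonpos.2 hcos.le))]
    congr 1
    ring
  have hS : 0 ≤ ∫ v in (0:ℝ)..θ, Real.sin v ^ p :=
    integral_nonneg (by linarith [Real.pi_pos]) fun v hv =>
      Real.rpow_nonneg (Real.sin_nonneg_of_nonneg_of_le_pi hv.1 (by linarith [hv.2])) _
  have hkey : (1 - p / 2 * (π * q) ^ 2 / Real.log b ^ 2) * (1 + (α * q) ^ 2) ^ (p / 2) ≤ 1 := by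
    refine one_sub_mul_one_add_rpow_le_one (by positivity) (by positivity) ?_
    calc p / 2 * (α * q) ^ 2 ≤ p / 2 * (π / Real.log b * q) ^ 2 := by gcongr
      _ = p / 2 * (π * q) ^ 2 / Real.log b ^ 2 := by ring
  rw [hleft, hright, hR, ge_iff_le]
  calc _ = q ^ p * (α⁻¹ * ∫ v in (0:ℝ)..θ, Real.sin v ^ p) *
        ((1 - p / 2 * (π * q) ^ 2 / Real.log b ^ 2) * (1 + (α * q) ^ 2) ^ (p / 2)) := by ring
    _ ≤ _ := mul_le_of_le_one_right (by positivity) hkey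
end

section
/- Let p ≥ 2 be a real number. There exist constants C₁ > 0 and C₂ > 0 depending only on p such that for all real numbers 0 < a < b with ln(b/a) ≥ 1: (i) for every measurable f : ℝ → ℝ with f ≥ 0 on (a,b) and ∫_a^b f^p < ∞, ∫_a^b ((1/x) ∫_a^x f(t) dt)^p dx ≤ ((p/(p-1))^p − C₂/(ln(b/a))²) ∫_a^b f(x)^p dx; and (ii) there exists a measurable f : ℝ → ℝ with f ≥ 0 on (a,b), 0 < ∫_a^b f^p < ∞, such that ∫_a^b ((1/x) ∫_a^x f(t) dt)^p dx ≥ ((p/(p-1))^p − C₁/(ln(b/a))²) ∫_a^b f(x)^p dx. -/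
open Real MeasureTheory intervalIntegral

theorem LipschitzOnWith.comp_absolutelyContinuousOnInterval {X Y : Type*} [PseudoMetricSpace X]
    [PseudoMetricSpace Y] {φ : X → Y} {K : NNReal} {s : Set X} {f : ℝ → X} {a b : ℝ}
    (hφ : LipschitzOnWith K φ s) (hf : AbsolutelyContinuousOnInterval f a b)
    (hs : Set.MapsTo f (Set.uIcc a b) s) :
    AbsolutelyContinuousOnInterval (fun x => φ (f x)) a b := by
  refine squeeze_zero' (.of_forall fun E => Finset.sum_nonneg fun _ _ => dist_nonneg) ?_
    (by simpa using Filter.Tendsto.const_mul (K : ℝ) hf)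
  filter_upwards [Filter.mem_inf_of_right (Filter.mem_principal_self _)] with E hE
  rw [Finset.mul_sum]
  exact Finset.sum_le_sum fun i hi =>
    hφ.dist_le_mul _ (hs (hE.1 i hi).1) _ (hs (hE.1 i hi).2)

theorem AbsolutelyContinuousOnInterval.rpow_const {f : ℝ → ℝ} {a b p : ℝ}
    (hf : AbsolutelyContinuousOnInterval f a b) (hp : 1 ≤ p) :
    AbsolutelyContinuousOnInterval (fun x => f x ^ p) a b := by
  obtain ⟨C, hC⟩ := hf.exists_bound
  obtain ⟨K, hK⟩ := (Real.contDiff_rpow_const_of_le (n := 1) (by simpa using hp)).contDiffOn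
    |>.exists_lipschitzOnWith (s := Set.Icc (-C) C) (by simp) (convex_Icc _ _) isCompact_Icc
  exact hK.comp_absolutelyContinuousOnInterval hf fun x hx => abs_le.1 (hC x hx)

/-- Bound for the averaging operator by a nonnegative supersolution `g` of the Riccati-type
equation `g' + (p - 1) g ^ q + x ^ (-p) / d = 0`. -/
theorem hardy_of_riccati_supersolution {p q d a b : ℝ} (hpq : p.HolderConjugate q) (hd : 0 < d)
    (ha : 0 < a) (hab : a < b) {g g' : ℝ → ℝ} (hg : AbsolutelyContinuousOnInterval g a b)
    (hg' : ∀ x ∈ Set.Ioo a b, HasDerivAt g (g' x) x) (hg0 : ∀ x ∈ Set.Ioc a b, 0 ≤ g x)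
    (hineq : ∀ x ∈ Set.Ioo a b, g' x + (p - 1) * g x ^ q + x ^ (-p) / d ≤ 0)
    {f : ℝ → ℝ} (hfm : Measurable f) (hf0 : ∀ x ∈ Set.Ioo a b, 0 ≤ f x)
    (hfp : IntervalIntegrable (fun x => f x ^ p) volume a b) :
    ∫ x in a..b, ((1 / x) * ∫ t in a..x, f t) ^ p ≤ d * ∫ x in a..b, f x ^ p := by
  have hp : 1 < p := hpq.lt
  have hf : IntervalIntegrable f volume a b := by
    rw [intervalIntegrable_iff_integrableOn_Ioo_of_le hab.le] at hfp ⊢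
    refine Integrable.mono' ((integrable_const (1 : ℝ)).add hfp) hfm.aestronglyMeasurable ?_
    filter_upwards [ae_restrict_mem measurableSet_Ioo] with x hx
    rw [Real.norm_of_nonneg (hf0 x hx)]
    change f x ≤ 1 + f x ^ p
    have h0 := Real.rpow_nonneg (hf0 x hx) p
    rcases le_total (f x) 1 with h | h
    · linarith
    · linarith [Real.self_le_rpow_of_one_le h hp.le]
  set F : ℝ → ℝ := fun x => ∫ t in a..x, f t with hF
  have hFac : AbsolutelyContinuousOnInterval F a b :=
    hf.absolutelyContinuousOnInterval_intervalIntegral (by simp)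
  have hF0 : ∀ x ∈ Set.Icc a b, 0 ≤ F x := fun x hx => by
    rw [hF]
    simp only
    rw [intervalIntegral.integral_of_le hx.1, integral_Ioc_eq_integral_Ioo]
    exact setIntegral_nonneg measurableSet_Ioo fun t ht => hf0 t ⟨ht.1, ht.2.trans_le hx.2⟩
  have hFp := hFac.rpow_const hp.le
  have hint : IntervalIntegrable (fun x => ((1 / x) * F x) ^ p) volume a b := by
    refine ContinuousOn.intervalIntegrable (ContinuousOn.rpow_const (ContinuousOn.mul ?_
      hFac.continuousOn) fun _ _ => Or.inr (by linarith))
    refine continuousOn_const.div continuousOn_id fun x hx => ?_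
    rw [Set.uIcc_of_le hab.le] at hx
    exact (ha.trans_le hx.1).ne'
  have hH := hFp.mul hg
  have hderiv := hH.integral_deriv_eq_sub
  have hHint := hH.intervalIntegrable_deriv
  have hFa : F a = 0 := by simp [hF]
  simp only [Pi.mul_apply, hFa, Real.zero_rpow hpq.ne_zero, zero_mul, sub_zero] at hderiv
  have hpos : 0 ≤ d * ∫ x in a..b, deriv ((fun x => F x ^ p) * g) x := by
    rw [hderiv]
    have := hF0 b ⟨hab.le, le_rfl⟩
    have := hg0 b ⟨hab, le_rfl⟩
    positivity
  suffices ∫ x in a..b, (((1 / x) * F x) ^ p + d * deriv ((fun x => F x ^ p) * g) x) ≤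
      ∫ x in a..b, d * f x ^ p by
    rw [intervalIntegral.integral_add hint (hHint.const_mul d), intervalIntegral.integral_const_mul,
      intervalIntegral.integral_const_mul] at this
    linarith
  simp only [intervalIntegral.integral_of_le hab.le, integral_Ioc_eq_integral_Ioo]
  refine setIntegral_mono_on_ae
    ((intervalIntegrable_iff_integrableOn_Ioo_of_le hab.le).1 (hint.add (hHint.const_mul d)))
    ((intervalIntegrable_iff_integrableOn_Ioo_of_le hab.le).1 (hfp.const_mul d))
    measurableSet_Ioo ?_
  filter_upwards [hf.ae_hasDerivAt_integral] with x hxd hx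
  have hx0 : 0 < x := ha.trans hx.1
  have hFx := hF0 x ⟨hx.1.le, hx.2.le⟩
  have hgx := hg0 x ⟨hx.1, hx.2.le⟩
  have hfx := hf0 x hx
  have hdF : HasDerivAt F (f x) x :=
    hxd (Set.uIcc_of_le hab.le ▸ ⟨hx.1.le, hx.2.le⟩) a (by simp)
  rw [((hdF.rpow_const (Or.inr hp.le)).mul (hg' x hx)).deriv]
  have hyoung := Real.young_inequality_of_nonneg hfx
    (mul_nonneg (Real.rpow_nonneg hFx (p - 1)) hgx) hpq
  rw [Real.mul_rpow (Real.rpow_nonneg hFx _) hgx, ← Real.rpow_mul hFx, hpq.sub_one_mul_conj]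
    at hyoung
  have hpq' : p * (F x ^ p * g x ^ q / q) = (p - 1) * (F x ^ p * g x ^ q) := by
    rw [← hpq.div_conj_eq_sub_one]; ring
  have hyoung' : p * (f x * (F x ^ (p - 1) * g x)) ≤
      f x ^ p + (p - 1) * (F x ^ p * g x ^ q) := by
    have := mul_le_mul_of_nonneg_left hyoung hpq.nonneg
    rwa [mul_add, hpq', mul_div_cancel₀ _ hpq.ne_zero] at this
  have hxp : ((1 / x) * F x) ^ p = F x ^ p * x ^ (-p) := by
    rw [Real.mul_rpow (by positivity) hFx, one_div, Real.inv_rpow hx0.le, Real.rpow_neg hx0.le,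
      mul_comm]
  have h1 := mul_le_mul_of_nonneg_left (hineq x hx) (mul_nonneg hd.le (Real.rpow_nonneg hFx p))
  have h2 := mul_le_mul_of_nonneg_left hyoung' hd.le
  have h3 : d * F x ^ p * (g' x + (p - 1) * g x ^ q + x ^ (-p) / d) =
    d * F x ^ p * (g' x + (p - 1) * g x ^ q) + F x ^ p * x ^ (-p) := by
    field_simp
  rw [h3] at h1
  rw [hxp]
  linarith

theorem one_sub_rpow_le {q η : ℝ} (hq : 1 ≤ q) (hq2 : q ≤ 2) (hη : η ≤ 1) :
    (1 - η) ^ q ≤ 1 - q * η + (q - 1) * η ^ 2 := by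
  have h := rpow_one_add_le_one_add_mul_self (s := -η) (by linarith) (p := q - 1)
    (by linarith) (by linarith)
  have h1 : (1 - η) ^ q = (1 + -η) ^ (q - 1) * (1 - η) := by
    rcases eq_or_ne (1 - η) 0 with h0 | h0
    · rw [h0, Real.zero_rpow (by linarith), mul_zero]
    · rw [← sub_eq_add_neg, Real.rpow_sub_one h0, div_mul_cancel₀ _ h0]
  rw [h1]
  nlinarith

theorem hardy_finite_interval_upper_s4 {p q a b : ℝ} (hpq : p.HolderConjugate q) (hp2 : 2 ≤ p)
    (ha : 0 < a) (hab : a < b) (hL : 1 ≤ Real.log (b / a))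
    {f : ℝ → ℝ} (hfm : Measurable f) (hf0 : ∀ x ∈ Set.Ioo a b, 0 ≤ f x)
    (hfp : IntervalIntegrable (fun x => f x ^ p) volume a b) :
    ∫ x in a..b, ((1 / x) * ∫ t in a..x, f t) ^ p ≤
      (q ^ p - q ^ p / 8 / (Real.log (b / a)) ^ 2) * ∫ x in a..b, f x ^ p := by
  set L := Real.log (b / a) with hLdef
  have hq0 : 0 < q := hpq.symm.pos
  have hq1 : 1 < q := hpq.symm.lt
  have hmul : (p - 1) * (q - 1) = 1 := by linarith [hpq.mul_eq_add]
  have hq2 : q ≤ 2 := by nlinarith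
  have hqp : 0 < q ^ p := Real.rpow_pos_of_pos hq0 p
  have hL2 : 1 ≤ L ^ 2 := by nlinarith
  have hcont : ∀ x ∈ Set.Icc a b, HasDerivAt
      (fun x => x ^ (1 - p) * (q * q ^ (-p) * (1 - Real.log (x / a) / (2 * L ^ 2))))
      (x ^ (-p) * ((1 - p) * (q * q ^ (-p) * (1 - Real.log (x / a) / (2 * L ^ 2)))
        - q * q ^ (-p) / (2 * L ^ 2))) x := by
    intro x hx
    have hx0 : 0 < x := ha.trans_le hx.1
    have h1 := Real.hasDerivAt_rpow_const (x := x) (p := 1 - p) (Or.inl hx0.ne')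
    have h2 := ((((hasDerivAt_id x).div_const a).log (by simp; grind)).div_const
      (2 * L ^ 2)).const_sub 1 |>.const_mul (q * q ^ (-p))
    convert! h1.mul h2 using 1
    have h3 : x ^ (1 - p) = x * x ^ (-p) := by
      rw [sub_eq_add_neg, Real.rpow_add hx0, Real.rpow_one]
    simp only [id, h3, show (1 - p - 1) = -p by ring]
    field_simp
    ring
  have hη : ∀ x ∈ Set.Icc a b, 0 ≤ Real.log (x / a) / (2 * L ^ 2) ∧
      Real.log (x / a) / (2 * L ^ 2) ≤ 1 / 2 ∧
      (Real.log (x / a) / (2 * L ^ 2)) ^ 2 ≤ 1 / (4 * L ^ 2) := by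
    intro x hx
    have h0 : 0 ≤ Real.log (x / a) := Real.log_nonneg ((one_le_div ha).2 hx.1)
    have h1 : Real.log (x / a) ≤ L := Real.log_le_log (div_pos (ha.trans_le hx.1) ha)
      (by gcongr; exact hx.2)
    refine ⟨by positivity, ?_, ?_⟩
    · rw [div_le_iff₀ (by positivity)]; nlinarith
    · rw [div_pow, div_le_div_iff₀ (by positivity) (by positivity)]
      have : Real.log (x / a) ^ 2 ≤ L ^ 2 := by gcongr
      nlinarith [sq_nonneg L]
  have hlip : AbsolutelyContinuousOnInterval
      (fun x => x ^ (1 - p) * (q * q ^ (-p) * (1 - Real.log (x / a) / (2 * L ^ 2)))) a b := by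
    apply ContDiffOn.absolutelyContinuousOnInterval
    rw [Set.uIcc_of_le hab.le]
    have hne : ∀ x ∈ Set.Icc a b, x ≠ 0 := fun x hx => (ha.trans_le hx.1).ne'
    refine (contDiffOn_id.rpow_const_of_ne hne).mul (contDiffOn_const.mul
      (contDiffOn_const.sub
        ((ContDiffOn.log (contDiffOn_id.div_const a) fun x hx => ?_).div_const _)))
    exact div_ne_zero (hne x hx) ha.ne'
  have hd : q ^ p - q ^ p / 8 / L ^ 2 = q ^ p * (1 - 1 / (8 * L ^ 2)) := by field_simp
  have hd1 : 1 / (8 * L ^ 2) ≤ 1 / 8 := by gcongr; linarith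
  have hdpos : 0 < 1 - 1 / (8 * L ^ 2) := by linarith
  refine hardy_of_riccati_supersolution hpq (hd ▸ mul_pos hqp hdpos) ha hab hlip
    (fun x hx => hcont x ⟨hx.1.le, hx.2.le⟩) ?_ ?_ hfm hf0 hfp
  · intro x hx
    have h0 : 0 < x := ha.trans hx.1
    have := (hη x ⟨hx.1.le, hx.2⟩).2.1
    have : 0 ≤ 1 - Real.log (x / a) / (2 * L ^ 2) := by linarith
    positivity
  · intro x hx
    have hx0 : 0 < x := ha.trans hx.1
    obtain ⟨-, hη1, hη2⟩ := hη x ⟨hx.1.le, hx.2.le⟩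
    set η := Real.log (x / a) / (2 * L ^ 2)
    have hηn : 0 ≤ 1 - η := by linarith
    have hexp : (1 - p) * q = -p := by linarith [hpq.sub_one_mul_conj]
    have hpow : (x ^ (1 - p) * (q * q ^ (-p) * (1 - η))) ^ q =
        x ^ (-p) * (q ^ (-p) * (1 - η) ^ q) := by
      have : q * q ^ (-p) = q ^ (1 - p) := by
        rw [sub_eq_add_neg, Real.rpow_add hq0, Real.rpow_one]
      rw [this, Real.mul_rpow (by positivity) (by positivity), Real.mul_rpow (by positivity) hηn,
        ← Real.rpow_mul hx0.le, ← Real.rpow_mul hq0.le, hexp]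
    have hinv : (1 - 1 / (8 * L ^ 2))⁻¹ ≤ 1 + 1 / (4 * L ^ 2) := by
      rw [inv_le_iff_one_le_mul₀ hdpos]
      have : 1 / (4 * L ^ 2) = 2 * (1 / (8 * L ^ 2)) := by field_simp; norm_num
      have h8 : 0 ≤ 1 / (8 * L ^ 2) := by positivity
      rw [this]
      nlinarith
    have hbern := one_sub_rpow_le (η := η) hq1.le hq2 (by linarith)
    have hdiv : x ^ (-p) / (q ^ p - q ^ p / 8 / L ^ 2) =
        x ^ (-p) * (q ^ (-p) * (1 - 1 / (8 * L ^ 2))⁻¹) := by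
      rw [hd, Real.rpow_neg hq0.le, div_eq_mul_inv, mul_inv]
    rw [hpow, hdiv]
    have hmain : (1 - p) * (q * (1 - η)) - q / (2 * L ^ 2) + (p - 1) * (1 - η) ^ q +
        (1 - 1 / (8 * L ^ 2))⁻¹ ≤ 0 := by
      have h1 := mul_le_mul_of_nonneg_left hbern (sub_nonneg.2 hpq.lt.le)
      have h2 : (1 - p) * (q * (1 - η)) + (p - 1) * (1 - q * η + (q - 1) * η ^ 2) =
          ((p - 1) * (q - 1)) * (η ^ 2 - 1) := by ring
      rw [hmul] at h2
      have h3 : 1 / (2 * L ^ 2) ≤ q / (2 * L ^ 2) := by gcongr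
      have h4 : 1 / (2 * L ^ 2) = 1 / (4 * L ^ 2) + 1 / (4 * L ^ 2) := by field_simp; norm_num
      linarith
    have := mul_nonpos_of_nonneg_of_nonpos
      (mul_nonneg (Real.rpow_nonneg hx0.le (-p)) (Real.rpow_nonneg hq0.le (-p))) hmain
    refine le_trans (le_of_eq ?_) this
    ring

theorem integral_comp_log_div_mul_inv {a b : ℝ} (ha : 0 < a) (hab : a < b) {G : ℝ → ℝ}
    (hG : Continuous G) :
    ∫ x in a..b, G (Real.log (x / a)) * x⁻¹ = ∫ s in (0 : ℝ)..Real.log (b / a), G s := by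
  have hpos : ∀ x ∈ Set.uIcc a b, 0 < x := fun x hx => by
    rw [Set.uIcc_of_le hab.le] at hx
    exact ha.trans_le hx.1
  have h := intervalIntegral.integral_comp_mul_deriv (a := a) (b := b)
    (f := fun x => Real.log (x / a)) (f' := fun x => x⁻¹) (g := G) (fun x hx => ?_)
    (continuousOn_id.inv₀ fun x hx => (hpos x hx).ne') hG
  · simpa [div_self ha.ne'] using h
  · have hx0 := hpos x hx
    convert! ((hasDerivAt_id x).div_const a).log (div_ne_zero hx0.ne' ha.ne') using 1
    simp only [id]
    field_simp

theorem sub_le_rpow_sub_of_nonneg {p y c : ℝ} (hp : 1 ≤ p) (hy : 0 ≤ y) (hc : 0 < c) :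
    (y + c) ^ p - p * c * (y + c) ^ (p - 1) ≤ y ^ p := by
  have hY : 0 < y + c := by linarith
  have hle : c / (y + c) ≤ 1 := (div_le_one hY).2 (by linarith)
  have h := one_add_mul_self_le_rpow_one_add (s := -(c / (y + c))) (by linarith) hp
  have h1 : y = (y + c) * (1 + -(c / (y + c))) := by field_simp; ring
  have h2 : y ^ p = (y + c) ^ p * (1 + -(c / (y + c))) ^ p := by
    conv_lhs => rw [h1]
    rw [Real.mul_rpow hY.le (by linarith)]
  rw [h2, Real.rpow_sub_one hY.ne']
  refine le_trans (le_of_eq ?_) (mul_le_mul_of_nonneg_left h (Real.rpow_nonneg hY.le p))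
  field_simp
  ring

theorem integral_parabola_rpow_ge {p q L : ℝ} (hp : 1 < p) (hq0 : 0 < q) (hq2 : q ≤ 2)
    (hL : 1 ≤ L) :
    (1 - 8 * p / 7 * 112 ^ p / L ^ 2) * ∫ s in (0 : ℝ)..L, (s * (L + q - s) + q ^ 2) ^ p ≤
      ∫ s in (0 : ℝ)..L, (s * (L + q - s)) ^ p := by
  have hL0 : 0 < L := by linarith
  have hint : ∀ c : ℝ, ∀ r : ℝ, 0 ≤ r →
      Continuous (fun s : ℝ => (s * (L + q - s) + c) ^ r) := fun c r hr =>
    Continuous.rpow_const (by fun_prop) fun _ => Or.inr hr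
  have hφ : ∀ s ∈ Set.Icc 0 L, 0 ≤ s * (L + q - s) := fun s hs =>
    mul_nonneg hs.1 (by linarith [hs.2])
  have hI := fun c r hr => (hint c r hr).intervalIntegrable (μ := volume) 0 L
  have hq4 : q ^ 2 ≤ 4 := by nlinarith
  have hupper : (∫ s in (0 : ℝ)..L, (s * (L + q - s) + q ^ 2) ^ p) -
      p * q ^ 2 * (∫ s in (0 : ℝ)..L, (s * (L + q - s) + q ^ 2) ^ (p - 1)) ≤
      ∫ s in (0 : ℝ)..L, (s * (L + q - s)) ^ p := by
    rw [← intervalIntegral.integral_const_mul, ← intervalIntegral.integral_sub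
      (hI _ _ (by linarith)) ((hI _ _ (by linarith)).const_mul _)]
    refine intervalIntegral.integral_mono_on hL0.le
      ((hI _ _ (by linarith)).sub ((hI _ _ (by linarith)).const_mul _))
      (by simpa using hI 0 p (by linarith)) fun s hs => ?_
    exact sub_le_rpow_sub_of_nonneg hp.le (hφ s hs) (by positivity)
  have hsmall : ∫ s in (0 : ℝ)..L, (s * (L + q - s) + q ^ 2) ^ (p - 1) ≤
      L * (7 * L ^ 2) ^ (p - 1) := by
    refine (intervalIntegral.integral_mono_on (g := fun _ => (7 * L ^ 2) ^ (p - 1)) hL0.le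
      (hI _ _ (by linarith)) (by simp) fun s hs => ?_).trans (by simp)
    refine Real.rpow_le_rpow (add_nonneg (hφ s hs) (sq_nonneg q)) ?_ (by linarith)
    have : s * (L + q - s) ≤ L * (L + 2) :=
      mul_le_mul hs.2 (by linarith [hs.1]) (by linarith [hs.2]) hL0.le
    nlinarith
  have hlarge : L / 2 * (L ^ 2 / 16) ^ p ≤
      ∫ s in (0 : ℝ)..L, (s * (L + q - s) + q ^ 2) ^ p := by
    refine le_trans ?_ (intervalIntegral.integral_mono_interval (a := L / 4) (b := 3 * L / 4)
      (by linarith) (by linarith) (by linarith) ?_ (hI _ _ (by linarith)))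
    · refine le_trans (le_of_eq ?_) (intervalIntegral.integral_mono_on
        (f := fun _ => (L ^ 2 / 16) ^ p) (by linarith) (by simp)
        ((hint _ _ (by linarith)).intervalIntegrable _ _) fun s hs => ?_)
      · simp only [intervalIntegral.integral_const, smul_eq_mul]
        ring
      · refine Real.rpow_le_rpow (by positivity) ?_ (by linarith)
        have : L / 4 * (L / 4) ≤ s * (L + q - s) :=
          mul_le_mul hs.1 (by linarith [hs.2]) (by linarith) (by linarith [hs.1])
        nlinarith [sq_nonneg q]
    · filter_upwards [ae_restrict_mem measurableSet_Ioc] with s hs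
      exact Real.rpow_nonneg (add_nonneg (hφ s ⟨hs.1.le, hs.2⟩) (sq_nonneg q)) p
  have hcmp : p * q ^ 2 * (L * (7 * L ^ 2) ^ (p - 1)) ≤
      8 * p / 7 * 112 ^ p / L ^ 2 * (L / 2 * (L ^ 2 / 16) ^ p) := by
    have h1 : (7 * L ^ 2) ^ p = 112 ^ p * (L ^ 2 / 16) ^ p := by
      rw [← Real.mul_rpow (by norm_num) (by positivity)]
      congr 1
      ring
    rw [Real.rpow_sub_one (by positivity), h1]
    calc p * q ^ 2 * (L * (112 ^ p * (L ^ 2 / 16) ^ p / (7 * L ^ 2)))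
        ≤ p * 4 * (L * (112 ^ p * (L ^ 2 / 16) ^ p / (7 * L ^ 2))) := by gcongr
      _ = _ := by field_simp; ring
  have h1 := mul_le_mul_of_nonneg_left hsmall (show 0 ≤ p * q ^ 2 by positivity)
  have h2 := mul_le_mul_of_nonneg_left hlarge
    (show 0 ≤ 8 * p / 7 * 112 ^ p / L ^ 2 by positivity)
  linarith

theorem hardy_finite_interval_lower {p q a b : ℝ} (hpq : p.HolderConjugate q) (hp2 : 2 ≤ p)
    (ha : 0 < a) (hab : a < b) (hL : 1 ≤ Real.log (b / a)) :
    ∃ f : ℝ → ℝ, Measurable f ∧ (∀ x ∈ Set.Ioo a b, 0 ≤ f x) ∧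
      IntervalIntegrable (fun x => f x ^ p) volume a b ∧ 0 < (∫ x in a..b, f x ^ p) ∧
      (q ^ p - q ^ p * (8 * p / 7 * 112 ^ p) / (Real.log (b / a)) ^ 2) *
        (∫ x in a..b, f x ^ p) ≤ ∫ x in a..b, ((1 / x) * ∫ t in a..x, f t) ^ p := by
  set L := Real.log (b / a) with hLdef
  have hq0 : 0 < q := hpq.symm.pos
  have hp0 : 0 < p := hpq.pos
  have hq2 : q ≤ 2 := by nlinarith [hpq.mul_eq_add, hpq.symm.lt]
  have hpos : ∀ x ∈ Set.Icc a b, 0 < x := fun x hx => ha.trans_le hx.1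
  have hlog : ∀ x ∈ Set.Icc a b, Real.log (x / a) ∈ Set.Icc 0 L := fun x hx =>
    ⟨Real.log_nonneg ((one_le_div ha).2 hx.1), Real.log_le_log (div_pos (hpos x hx) ha)
      (by gcongr; exact hx.2)⟩
  have hψ : ∀ s ∈ Set.Icc 0 L, 0 < (s + q) * (L - s) + q ^ 2 := fun s hs =>
    add_pos_of_nonneg_of_pos (mul_nonneg (by linarith [hs.1]) (by linarith [hs.2]))
      (by positivity)
  set f : ℝ → ℝ := fun x => x ^ (-(1 / p)) *
    (((Real.log (x / a) + q) * (L - Real.log (x / a)) + q ^ 2) / q) with hf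
  have hf0 : ∀ x ∈ Set.Icc a b, 0 < f x := fun x hx => by
    have := hψ _ (hlog x hx)
    have := hpos x hx
    positivity
  have hfc : ContinuousOn f (Set.Icc a b) := by
    have hlogc : ContinuousOn (fun x => Real.log (x / a)) (Set.Icc a b) :=
      (continuousOn_id.div_const a).log fun x hx => (div_pos (hpos x hx) ha).ne'
    refine (continuousOn_id.rpow_const fun x hx => Or.inl (hpos x hx).ne').mul
      (ContinuousOn.div_const (((hlogc.add continuousOn_const).mul
        (continuousOn_const.sub hlogc)).add continuousOn_const) _)
  have hfpc : ContinuousOn (fun x => f x ^ p) (Set.Icc a b) :=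
    hfc.rpow_const fun x hx => Or.inl (hf0 x hx).ne'
  have hfpI : IntervalIntegrable (fun x => f x ^ p) volume a b :=
    ContinuousOn.intervalIntegrable (by rwa [Set.uIcc_of_le hab.le])
  have hF : ∀ x ∈ Set.Icc a b, ∫ t in a..x, f t =
      x ^ (1 / q) * (Real.log (x / a) * (L + q - Real.log (x / a))) := by
    intro x hx
    have hsub : Set.uIcc a x ⊆ Set.Icc a b := by
      rw [Set.uIcc_of_le hx.1]
      exact Set.Icc_subset_Icc_right hx.2
    rw [intervalIntegral.integral_eq_sub_of_hasDerivAt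
      (f := fun x => x ^ (1 / q) * (Real.log (x / a) * (L + q - Real.log (x / a))))
      (fun t ht => ?_) (hfc.mono hsub).intervalIntegrable]
    · simp [div_self ha.ne']
    · have ht0 := hpos t (hsub ht)
      have h1 := Real.hasDerivAt_rpow_const (x := t) (p := 1 / q) (Or.inl ht0.ne')
      have h2 := ((hasDerivAt_id t).div_const a).log (div_ne_zero ht0.ne' ha.ne')
      convert! h1.mul (h2.mul (h2.const_sub (L + q))) using 1
      have hexp : 1 / q - 1 = -(1 / p) := by
        have := hpq.inv_add_inv_eq_one
        simp only [one_div]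
        linarith
      have h3 : t ^ (1 / q) = t * t ^ (-(1 / p)) := by
        rw [← hexp, Real.rpow_sub_one ht0.ne', mul_div_cancel₀ _ ht0.ne']
      simp only [hf, hexp, h3, id, Pi.mul_apply]
      field_simp
      ring
  have hA : ∫ x in a..b, ((1 / x) * ∫ t in a..x, f t) ^ p =
      ∫ s in (0 : ℝ)..L, (s * (L + q - s)) ^ p := by
    rw [← integral_comp_log_div_mul_inv ha hab (G := fun s => (s * (L + q - s)) ^ p)
      (Continuous.rpow_const (by fun_prop) fun _ => Or.inr hp0.le)]
    refine intervalIntegral.integral_congr fun x hx => ?_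
    rw [Set.uIcc_of_le hab.le] at hx
    have hx0 := hpos x hx
    have hs := hlog x hx
    have hφ : 0 ≤ Real.log (x / a) * (L + q - Real.log (x / a)) :=
      mul_nonneg hs.1 (by linarith [hs.2])
    simp only [hF x hx]
    rw [← mul_assoc, Real.mul_rpow (by positivity) hφ, mul_comm]
    congr 1
    have : 1 / x * x ^ (1 / q) = x ^ (-(1 / p)) := by
      rw [one_div, ← Real.rpow_neg_one, ← Real.rpow_add hx0]
      congr 1
      have := hpq.inv_add_inv_eq_one
      simp only [one_div]
      linarith
    rw [this, ← Real.rpow_mul hx0.le, neg_mul, one_div_mul_cancel hp0.ne', Real.rpow_neg_one]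
  have hB : ∫ x in a..b, f x ^ p =
      (q ^ p)⁻¹ * ∫ s in (0 : ℝ)..L, (s * (L + q - s) + q ^ 2) ^ p := by
    have hrefl := intervalIntegral.integral_comp_sub_left (a := 0) (b := L)
      (fun s => (s * (L + q - s) + q ^ 2) ^ p) L
    rw [sub_self, sub_zero] at hrefl
    rw [← hrefl, ← intervalIntegral.integral_const_mul, ← integral_comp_log_div_mul_inv ha hab
      (G := fun s => (q ^ p)⁻¹ * ((L - s) * (L + q - (L - s)) + q ^ 2) ^ p)
      (continuous_const.mul (Continuous.rpow_const (by fun_prop) fun _ => Or.inr hp0.le))]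
    refine intervalIntegral.integral_congr fun x hx => ?_
    rw [Set.uIcc_of_le hab.le] at hx
    have hx0 := hpos x hx
    have hs := (hψ _ (hlog x hx)).le
    simp only [hf]
    rw [Real.mul_rpow (by positivity) (by positivity), Real.div_rpow hs hq0.le,
      ← Real.rpow_mul hx0.le, neg_mul, one_div_mul_cancel hp0.ne', Real.rpow_neg_one,
      mul_comm, div_eq_inv_mul]
    congr 4
    ring
  refine ⟨f, by fun_prop, fun x hx => (hf0 x ⟨hx.1.le, hx.2.le⟩).le, hfpI,
    intervalIntegral.intervalIntegral_pos_of_pos_on hfpI (fun x hx =>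
      Real.rpow_pos_of_pos (hf0 x ⟨hx.1.le, hx.2.le⟩) p) hab, ?_⟩
  rw [hA, hB]
  refine le_trans (le_of_eq ?_) (integral_parabola_rpow_ge hpq.lt hq0 hq2 hL)
  have : q ^ p ≠ 0 := (Real.rpow_pos_of_pos hq0 p).ne'
  field_simp

/-- Two-sided estimate for the best constant in the finite-interval Hardy inequality:
(p/(p-1))^p − C₁/ln²(b/a) ≤ d(a,b) ≤ (p/(p-1))^p − C₂/ln²(b/a). -/
theorem hardy_finite_interval_two_sided (p : ℝ) (hp : 2 ≤ p) :
    ∃ C₁ : ℝ, 0 < C₁ ∧ ∃ C₂ : ℝ, 0 < C₂ ∧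
      ∀ a b : ℝ, 0 < a → a < b → 1 ≤ Real.log (b / a) →
        ((∀ f : ℝ → ℝ, Measurable f → (∀ x ∈ Set.Ioo a b, 0 ≤ f x) →
            IntervalIntegrable (fun x => f x ^ p) MeasureTheory.volume a b →
            ∫ x in a..b, ((1 / x) * ∫ t in a..x, f t) ^ p
              ≤ ((p / (p - 1)) ^ p - C₂ / (Real.log (b / a)) ^ 2) *
                  ∫ x in a..b, f x ^ p) ∧
         (∃ f : ℝ → ℝ, Measurable f ∧ (∀ x ∈ Set.Ioo a b, 0 ≤ f x) ∧
            IntervalIntegrable (fun x => f x ^ p) MeasureTheory.volume a b ∧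
            0 < (∫ x in a..b, f x ^ p) ∧
            ∫ x in a..b, ((1 / x) * ∫ t in a..x, f t) ^ p
              ≥ ((p / (p - 1)) ^ p - C₁ / (Real.log (b / a)) ^ 2) *
                  ∫ x in a..b, f x ^ p)) := by
  have hpq : p.HolderConjugate (p / (p - 1)) :=
    Real.HolderConjugate.conjExponent (by linarith)
  have hqp : 0 < (p / (p - 1)) ^ p := Real.rpow_pos_of_pos hpq.symm.pos p
  refine ⟨(p / (p - 1)) ^ p * (8 * p / 7 * 112 ^ p), by positivity, (p / (p - 1)) ^ p / 8,
    by positivity, fun a b ha hab hL => ⟨fun f hfm hf0 hfp => ?_, ?_⟩⟩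
  · exact hardy_finite_interval_upper_s4 hpq hp ha hab hL hfm hf0 hfp
  · exact hardy_finite_interval_lower hpq hp ha hab hL
end

section
/- Let p ≥ 2 and 1/p + 1/q = 1, let 0 < ε < 1, and set b₀ = exp(π / √(m ε)) where m = min{ q/((p−q)(pq+1)²), 4/(pq)² } for p > 2 and m = 4/(pq)² when p = 2. Let b > b₀, let α be a real number in (π/(2 ln b), π/ln b) satisfying tan(α ln b) + α q = 0, and define f*(x) = x^{-1/p} (α q cos(α ln x) + sin(α ln x)). Then for all x ∈ [1, b], (sin(α ln x))^{p/q} ≥ −q · x^{1+1/q} · (d/dx)[(f*(x))^{p/q}] / (1 + (pq + ε) α²), where (d/dx)[(f*(x))^{p/q}] denotes the derivative at x of the function t ↦ (f*(t))^{p/q}. -/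
open Real

/-- A second-order upper bound for `(1 + y) ^ k`, valid for `k ≥ 1` and `0 ≤ k * y ≤ 1`. -/
lemma one_add_rpow_le_second_order {k y : ℝ} (hk : 1 ≤ k) (hy : 0 ≤ y) (hky : k * y ≤ 1) :
    (1 + y) ^ k ≤ 1 + k * y + (k - 1) * (k * y) ^ 2 := by
  have hn : 0 ≤ k - 1 := by linarith
  have hny0 : 0 ≤ (k - 1) * y := mul_nonneg hn hy
  have hny1 : (k - 1) * y ≤ 1 := by nlinarith
  have hy1 : y ≤ k := by nlinarith
  have hexp : (1 + y) ^ (k - 1) ≤ 1 + (k - 1) * y + ((k - 1) * y) ^ 2 := by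
    have h1 : (1 + y) ^ (k - 1) ≤ exp ((k - 1) * y) := by
      rw [mul_comm, exp_mul]
      exact rpow_le_rpow (by linarith) (by linarith [add_one_le_exp y]) hn
    have h2 := abs_le.1 (abs_exp_sub_one_sub_id_le (abs_le.2 ⟨by linarith, hny1⟩))
    linarith [h2.2]
  have hsplit : (1 + y) ^ k = (1 + y) ^ (k - 1) * (1 + y) := by
    rw [← rpow_add_one (by linarith : 1 + y ≠ 0), sub_add_cancel]
  have hmul := mul_le_mul_of_nonneg_right hexp (by linarith : 0 ≤ 1 + y)
  have hrem : 0 ≤ (k - 1) * y ^ 2 * ((k - 1) * (k - y)) := by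
    have : 0 ≤ k - y := by linarith
    positivity
  rw [hsplit]
  linarith

/-- Weighted AM-GM in product form: `g ^ (k - 1) * w` is at most the `k`-th power of the
mean of `g` and `w` with weights `(k - 1) / k` and `1 / k`. -/
lemma rpow_sub_one_mul_le_rpow {k g w v : ℝ} (hk : 1 ≤ k) (hg : 0 ≤ g) (hv : 0 ≤ v)
    (hsum : (k - 1) * g + w = k * v) : g ^ (k - 1) * w ≤ v ^ k := by
  rcases le_total w 0 with hw | hw
  · exact (mul_nonpos_of_nonneg_of_nonpos (rpow_nonneg hg _) hw).trans (rpow_nonneg hv _)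
  have hk0 : 0 < k := by linarith
  have hmean := geom_mean_le_arith_mean2_weighted (div_nonneg (by linarith : 0 ≤ k - 1) hk0.le)
    (by positivity : 0 ≤ 1 / k) hg hw (by field_simp; ring)
  have hv' : (k - 1) / k * g + 1 / k * w = v := by
    field_simp
    linarith
  rw [hv'] at hmean
  have hpow := rpow_le_rpow (by positivity) hmean hk0.le
  rwa [mul_rpow (by positivity) (by positivity), ← rpow_mul hg, ← rpow_mul hw,
    div_mul_cancel₀ _ hk0.ne', div_mul_cancel₀ _ hk0.ne', rpow_one] at hpow

/-- If `tan β = -a` with `β ∈ (π / 2, π)`, then `a cos θ + sin θ ≥ 0` on `[0, β]`. -/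
lemma mul_cos_add_sin_nonneg {a β θ : ℝ} (hβ : π / 2 < β) (hβπ : β < π)
    (htan : tan β + a = 0) (hθ0 : 0 ≤ θ) (hθ : θ ≤ β) : 0 ≤ a * cos θ + sin θ := by
  have hcos : cos β < 0 := cos_neg_of_pi_div_two_lt_of_lt hβ (by linarith)
  have hsin : sin β = -a * cos β := by
    rw [← tan_mul_cos hcos.ne]
    linear_combination cos β * htan
  have hdiff : 0 ≤ sin (β - θ) := sin_nonneg_of_nonneg_of_le_pi (by linarith) (by linarith)
  rw [sin_sub, hsin] at hdiff
  nlinarith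

/-- The derivative of `t ↦ (t ^ (-1 / p) (α q cos (α log t) + sin (α log t))) ^ (p - 1)`,
multiplied by `-q x ^ (1 + 1 / q)`, for conjugate exponents `p ≥ 2` and `q`. -/
lemma neg_mul_rpow_mul_deriv_eq {p q α x d : ℝ} (hp : 2 ≤ p) (hq : 0 < q)
    (hpq : p * q = p + q) (hx : 0 < x)
    (hg : 0 ≤ α * q * cos (α * log x) + sin (α * log x))
    (hd : HasDerivAt (fun t : ℝ =>
      (t ^ (-(1 / p)) * (α * q * cos (α * log t) + sin (α * log t))) ^ (p - 1)) d x) :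
    -q * x ^ (1 + 1 / q) * d = (α * q * cos (α * log x) + sin (α * log x)) ^ (p - 1 - 1) *
      ((1 + p * q * α ^ 2) * sin (α * log x) - α * (p - q) * cos (α * log x)) := by
  have hp0 : 0 < p := by linarith
  have hθ : HasDerivAt (fun t : ℝ => α * log t) (α * x⁻¹) x :=
    (hasDerivAt_log hx.ne').const_mul α
  have hpow : HasDerivAt (fun t : ℝ => t ^ (-(1 / p))) (-(1 / p) * x ^ (-(1 / p) - 1)) x :=
    hasDerivAt_rpow_const (Or.inl hx.ne')
  have hf := (hpow.mul ((hθ.cos.const_mul (α * q)).add hθ.sin)).rpow_const (p := p - 1)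
    (Or.inr (by linarith))
  have hd' := hd.unique hf
  simp only [Pi.mul_apply, Pi.add_apply] at hd'
  rw [hd', mul_rpow (by positivity) hg, ← rpow_mul hx.le, rpow_sub_one hx.ne']
  set c := cos (α * log x)
  set s := sin (α * log x)
  set G := (α * q * c + s) ^ (p - 1 - 1)
  have hexps : x ^ (1 + 1 / q) * (x ^ (-(1 / p) * (p - 1 - 1)) * x ^ (-(1 / p))) = x := by
    rw [← rpow_add hx, ← rpow_add hx]
    convert rpow_one x using 2
    field_simp
    linear_combination -hpq
  set X := x ^ (1 + 1 / q)
  set Y := x ^ (-(1 / p) * (p - 1 - 1))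
  set Z := x ^ (-(1 / p))
  have hfactor : (p - 1) * q = p := by linarith
  field_simp
  linear_combination
    (-q * (p - 1) * G * (-(α * q * c + s) + p * (α * c - α ^ 2 * q * s))) * hexps -
    x * G * (-(α * q * c + s) + p * (α * c - α ^ 2 * q * s)) * hfactor

/-- The smallness condition on `α ^ 2` gives `(1 + q² α²) ^ (p - 1) ≤ 1 + (p q + ε) α²`. -/
lemma one_add_sq_rpow_le {p q ε m α : ℝ} (hp : 2 ≤ p) (hq : 0 < q)
    (hpq : p * q = p + q) (hε0 : 0 < ε) (hε1 : ε < 1)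
    (hm : m = if p = 2 then 4 / (p * q) ^ 2
      else min (q / ((p - q) * (p * q + 1) ^ 2)) (4 / (p * q) ^ 2))
    (hα : α ^ 2 ≤ m * ε) :
    (1 + q ^ 2 * α ^ 2) ^ (p - 1) ≤ 1 + (p * q + ε) * α ^ 2 := by
  have hfactor : (p - 1) * q = p := by linarith
  have hP : 0 < p * q := by positivity
  have hP4 : 4 ≤ p * q := by nlinarith [sq_nonneg (p - q)]
  have hm4 : m ≤ 4 / (p * q) ^ 2 := by
    rw [hm]
    split_ifs
    exacts [le_rfl, min_le_right _ _]
  have hkz : (p - 1) * (q ^ 2 * α ^ 2) = p * q * α ^ 2 := by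
    linear_combination q * α ^ 2 * hfactor
  have hz : p * q * α ^ 2 ≤ 1 := by
    have h1 : α ^ 2 ≤ 4 / (p * q) ^ 2 * ε :=
      hα.trans (mul_le_mul_of_nonneg_right hm4 hε0.le)
    rw [div_mul_eq_mul_div, le_div_iff₀ (by positivity)] at h1
    nlinarith [sq_nonneg α]
  have hbound := one_add_rpow_le_second_order (by linarith : 1 ≤ p - 1)
    (by positivity : 0 ≤ q ^ 2 * α ^ 2) (hkz.trans_le hz)
  rw [hkz] at hbound
  have hrem : (p - 1 - 1) * (p * q) ^ 2 * α ^ 2 ≤ ε := by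
    rcases eq_or_ne p 2 with h2 | h2
    · rw [h2]
      norm_num
      exact hε0.le
    have hp2 : 0 < p - 2 := sub_pos.2 (lt_of_le_of_ne hp h2.symm)
    have hpq' : p - q = (p - 2) * q := by linarith
    rw [if_neg h2, hpq'] at hm
    have h1 : α ^ 2 ≤ q / ((p - 2) * q * (p * q + 1) ^ 2) * ε :=
      hα.trans (mul_le_mul_of_nonneg_right (hm ▸ min_le_left _ _) hε0.le)
    rw [div_mul_eq_mul_div, le_div_iff₀ (by positivity)] at h1
    have h2 : (p - 2) * (p * q + 1) ^ 2 * α ^ 2 ≤ ε := by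
      refine le_of_mul_le_mul_left ?_ hq
      linarith
    have h3 : (p - 2) * (p * q) ^ 2 * α ^ 2 ≤ (p - 2) * (p * q + 1) ^ 2 * α ^ 2 := by
      gcongr
      linarith
    linarith
  nlinarith [mul_le_mul_of_nonneg_right hrem (sq_nonneg α)]

/-- Key differential inequality for the almost extremal function
f*(x) = x^{-1/p}(αq cos(α ln x) + sin(α ln x)): at any point x ∈ [1,b] where
(f*)^{p/q} has a derivative d, one has
(sin(α ln x))^{p/q} ≥ −q x^{1+1/q} d / (1 + (pq+ε)α²). -/
theorem hardy_extremal_function_deriv_ineq (p q ε : ℝ) (hp : 2 ≤ p)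
    (hpq : 1 / p + 1 / q = 1) (hε0 : 0 < ε) (hε1 : ε < 1)
    (m : ℝ)
    (hm : m = if p = 2 then 4 / (p * q) ^ 2
          else min (q / ((p - q) * (p * q + 1) ^ 2)) (4 / (p * q) ^ 2))
    (b : ℝ) (hb : Real.exp (π / Real.sqrt (m * ε)) < b)
    (α : ℝ) (hα : α ∈ Set.Ioo (π / (2 * Real.log b)) (π / Real.log b))
    (htan : Real.tan (α * Real.log b) + α * q = 0) :
    ∀ x ∈ Set.Icc (1 : ℝ) b, ∀ d : ℝ,
      HasDerivAt (fun t : ℝ =>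
          (t ^ (-(1 / p)) * (α * q * Real.cos (α * Real.log t)
            + Real.sin (α * Real.log t))) ^ (p / q)) d x →
      (Real.sin (α * Real.log x)) ^ (p / q)
        ≥ -q * x ^ (1 + 1 / q) * d / (1 + (p * q + ε) * α ^ 2) := by
  intro x hx d hd
  have hp0 : 0 < p := by linarith
  have hq0 : 0 < q := by
    have h1 : 1 / p ≤ 1 / 2 := one_div_le_one_div_of_le two_pos hp
    exact one_div_pos.1 (by linarith)
  have hsum : p * q = p + q := by
    field_simp at hpq
    linarith
  have hk : p / q = p - 1 := by
    rw [div_eq_iff hq0.ne']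
    linarith
  have hm0 : 0 < m := by
    rw [hm]
    split_ifs with h2
    · positivity
    · have hp2 : 0 < p - 2 := sub_pos.2 (lt_of_le_of_ne hp (Ne.symm h2))
      have hpq' : p - q = (p - 2) * q := by linarith
      rw [hpq']
      positivity
  have hexp : π / √(m * ε) < log b := by
    rw [lt_log_iff_exp_lt ((exp_pos _).trans hb)]
    exact hb
  have hsqrt : 0 < √(m * ε) := sqrt_pos.2 (mul_pos hm0 hε0)
  have hL : 0 < log b := (div_pos pi_pos hsqrt).trans hexp
  obtain ⟨hα1, hα2⟩ := hα
  have hα0 : 0 < α := (div_pos pi_pos (by linarith)).trans hα1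
  have hβ : π / 2 < α * log b := by
    rw [div_lt_iff₀ (by linarith)] at hα1
    linarith
  have hβπ : α * log b < π := (lt_div_iff₀ hL).1 hα2
  have hαm : α ^ 2 ≤ m * ε := by
    rw [← le_sqrt' hα0]
    exact (hα2.trans ((div_lt_comm₀ hsqrt hL).1 hexp)).le
  have hx0 : 0 < x := by linarith [hx.1]
  have hθ0 : 0 ≤ α * log x := mul_nonneg hα0.le (log_nonneg hx.1)
  have hθ : α * log x ≤ α * log b := mul_le_mul_of_nonneg_left (log_le_log hx0 hx.2) hα0.le
  have hg := mul_cos_add_sin_nonneg hβ hβπ htan hθ0 hθ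
  have hs : 0 ≤ sin (α * log x) := sin_nonneg_of_nonneg_of_le_pi hθ0 (by linarith)
  rw [hk] at hd ⊢
  rw [neg_mul_rpow_mul_deriv_eq hp hq0 hsum hx0 hg hd, ge_iff_le, div_le_iff₀ (by positivity)]
  refine (rpow_sub_one_mul_le_rpow (v := sin (α * log x) * (1 + q ^ 2 * α ^ 2))
    (by linarith) hg (by positivity) ?_).trans ?_
  · linear_combination (α * cos (α * log x) - q * α ^ 2 * sin (α * log x)) * hsum
  · rw [mul_rpow hs (by positivity)]
    exact mul_le_mul_of_nonneg_left
      (one_add_sq_rpow_le hp hq0 hsum hε0 hε1 hm hαm) (rpow_nonneg hs _)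
end

section
/- Let p ≥ 2 and 1/p + 1/q = 1. There exists a constant c > 0 depending only on p such that for every natural number i ≥ 2, 2q² − 3/4 + 2q/(3 i^{2/q}) − 2q/i^{1+1/q} − q²/i^{1/q} − (ln²i − q ln i + (3/2)q²)/(2q i^{1/q}) > c. -/
open Real

/-- If `1 / p + 1 / q = 1` with `2 ≤ p`, then `1 ≤ q`. -/
theorem one_le_of_one_div_add_one_div_eq_one {p q : ℝ} (hp : 2 ≤ p)
    (hpq : 1 / p + 1 / q = 1) : 1 ≤ q := by
  have hp0 : 0 < 1 / p := by positivity
  have hp2 : 1 / p ≤ 1 / 2 := one_div_le_one_div_of_le (by norm_num) hp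
  have hq0 : 0 < q := by
    by_contra! h
    have := one_div_nonpos.2 h
    linarith
  have hq1 : 1 / q ≤ 1 := by linarith
  rwa [div_le_one hq0] at hq1

/-- A linear lower bound for `2 * q - 3 / 4 * (1 / q) - 1 / 25`. -/
theorem linear_le_two_mul_sub_inv {q : ℝ} (hq : 1 ≤ q) :
    6 / 5 * q ≤ 2 * q - 3 / 4 * (1 / q) - 1 / 25 := by
  have : 1 / q ≤ 1 := by rw [div_le_one (by linarith)]; exact hq
  linarith

/-- The rescaled bound for `n ≥ 3`. -/
theorem rescaled_bound_of_three_le {q t n : ℝ} (hq : 1 ≤ q) (hn : 3 ≤ n) (ht : 0 ≤ t)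
    (hnt : n = exp (q * t)) :
    exp t / 25 < (2 * q - 3 / 4 * (1 / q)) * exp t + 2 / 3 * (1 / exp t) - 2 / n - q
      - (t ^ 2 - t + 3 / 2) / 2 := by
  have hL : 1.0986 < q * t := by
    have h3 : log 3 ≤ log n := log_le_log (by norm_num) hn
    rw [hnt, log_exp] at h3
    linarith [log_three_gt_d9]
  have hinv : 2 / n ≤ 2 / 3 := div_le_div_of_nonneg_left (by norm_num) (by norm_num) hn
  have hE := quadratic_le_exp_of_nonneg ht
  have hE' : 0 < 1 / exp t := by positivity
  have h1 : 6 / 5 * q * exp t ≤ (2 * q - 3 / 4 * (1 / q) - 1 / 25) * exp t :=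
    mul_le_mul_of_nonneg_right (linear_le_two_mul_sub_inv hq) (exp_pos t).le
  have h2 : 6 / 5 * q * (1 + t + t ^ 2 / 2) ≤ 6 / 5 * q * exp t :=
    mul_le_mul_of_nonneg_left hE (by linarith)
  have h3 : 0 ≤ (q - 1) * t ^ 2 := mul_nonneg (by linarith) (sq_nonneg t)
  nlinarith [sq_nonneg t]

/-- The rescaled bound for `n = 2`. -/
theorem rescaled_bound_two {q t : ℝ} (hq : 1 ≤ q) (hnt : 2 = exp (q * t)) :
    exp t / 25 < (2 * q - 3 / 4 * (1 / q)) * exp t + 2 / 3 * (1 / exp t) - 2 / 2 - q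
      - (t ^ 2 - t + 3 / 2) / 2 := by
  have hL : q * t = log 2 := by rw [hnt, log_exp]
  have hL1 := log_two_gt_d9
  have hL2 := log_two_lt_d9
  obtain ⟨r, hr⟩ : ∃ r, r = 1 / q := ⟨_, rfl⟩
  have hqr : q * r = 1 := by rw [hr]; field_simp
  have hr0 : 0 < r := by rw [hr]; positivity
  have hr1 : r ≤ 1 := by nlinarith
  have htr : t = log 2 * r := by rw [← hL]; linear_combination (-t) * hqr
  have ht : 0 ≤ t := by rw [htr]; nlinarith
  have hE2 : exp t ≤ 2 := by
    rw [hnt]; exact exp_le_exp.2 (by nlinarith)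
  have hinv : 1 / 2 ≤ 1 / exp t := one_div_le_one_div_of_le (exp_pos t) hE2
  have hE := quadratic_le_exp_of_nonneg ht
  have h2 := mul_le_mul_of_nonneg_left hE
    ((by linarith : (0 : ℝ) ≤ 6 / 5 * q).trans (linear_le_two_mul_sub_inv hq))
  rw [← hr] at h2 ⊢
  have hqt : 2 * q * (1 + t + t ^ 2 / 2) = 2 * q + 2 * log 2 + log 2 * t := by
    rw [← hL]; ring
  have hqr2 : 2 - r ≤ q := by nlinarith [sq_nonneg (1 - r)]
  have ht1 : 0.693 * r ≤ t := by rw [htr]; nlinarith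
  have ht2 : t ≤ 0.694 * r := by rw [htr]; nlinarith
  have hLt : 0.693 * t ≤ log 2 * t := by nlinarith
  have htsq : t ^ 2 ≤ 0.482 * r ^ 2 := by nlinarith
  have hrt : r * t ≤ 0.694 * r ^ 2 := by nlinarith
  have hrt2 : r * t ^ 2 ≤ 0.482 * r ^ 2 := by nlinarith [sq_nonneg t, sq_nonneg r]
  have hrr : r ^ 2 ≤ r := by nlinarith
  nlinarith

/-- With `t = log n / q`, the expression equals `q / exp t` times its rescaled form. -/
theorem expression_eq_rescaled {q n t : ℝ} (hq : 0 < q) (hn : 0 < n) (ht : log n = q * t) :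
    2 * q ^ 2 - 3 / 4 + 2 * q / (3 * n ^ (2 / q)) - 2 * q / n ^ (1 + 1 / q)
        - q ^ 2 / n ^ (1 / q)
        - ((log n) ^ 2 - q * log n + (3 / 2) * q ^ 2) / (2 * q * n ^ (1 / q))
      = q * (((2 * q - 3 / 4 * (1 / q)) * exp t + 2 / 3 * (1 / exp t) - 2 / n - q
          - (t ^ 2 - t + 3 / 2) / 2) / exp t) := by
  have h1 : n ^ (1 / q) = exp t := by
    rw [rpow_def_of_pos hn, ht]
    congr 1
    field_simp
  have h2 : n ^ (2 / q) = exp t ^ 2 := by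
    rw [← h1, ← rpow_natCast, ← rpow_mul hn.le]
    congr 1
    push_cast
    ring
  have h3 : n ^ (1 + 1 / q) = n * exp t := by
    rw [rpow_add hn, rpow_one, h1]
  rw [h1, h2, h3, ht]
  have := (exp_pos t).ne'
  field_simp

/-- Lemma 10 of the paper: a uniform positive lower bound, depending only on p,
for the displayed expression, valid for all natural i ≥ 2. -/
theorem uniform_lower_bound_i (p q : ℝ) (hp : 2 ≤ p) (hpq : 1 / p + 1 / q = 1) :
    ∃ c : ℝ, 0 < c ∧ ∀ i : ℕ, 2 ≤ i →
      2 * q ^ 2 - 3 / 4 + 2 * q / (3 * (i : ℝ) ^ (2 / q))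
          - 2 * q / (i : ℝ) ^ (1 + 1 / q) - q ^ 2 / (i : ℝ) ^ (1 / q)
          - ((Real.log (i : ℝ)) ^ 2 - q * Real.log (i : ℝ) + (3 / 2) * q ^ 2)
              / (2 * q * (i : ℝ) ^ (1 / q))
        > c := by
  have hq := one_le_of_one_div_add_one_div_eq_one hp hpq
  have hq0 : 0 < q := by linarith
  refine ⟨1 / 25, by norm_num, fun i hi => ?_⟩
  have hi0 : (0 : ℝ) < i := by exact_mod_cast (by omega : 0 < i)
  obtain ⟨t, ht⟩ : ∃ t, log (i : ℝ) = q * t := ⟨log i / q, by field_simp⟩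
  have hexp : (i : ℝ) = exp (q * t) := by rw [← ht, exp_log hi0]
  rw [expression_eq_rescaled hq0 hi0 ht]
  have key : exp t / 25 < (2 * q - 3 / 4 * (1 / q)) * exp t + 2 / 3 * (1 / exp t)
      - 2 / (i : ℝ) - q - (t ^ 2 - t + 3 / 2) / 2 := by
    rcases hi.eq_or_lt with rfl | h3
    · exact_mod_cast rescaled_bound_two hq (by exact_mod_cast hexp)
    · have ht0 : 0 ≤ t := by
        have : 0 ≤ q * t := ht ▸ log_natCast_nonneg i
        exact nonneg_of_mul_nonneg_right this hq0
      exact rescaled_bound_of_three_le hq (by exact_mod_cast h3) ht0 hexp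
  have key' : 1 / 25 < ((2 * q - 3 / 4 * (1 / q)) * exp t + 2 / 3 * (1 / exp t)
      - 2 / (i : ℝ) - q - (t ^ 2 - t + 3 / 2) / 2) / exp t := by
    rw [lt_div_iff₀ (exp_pos t)]
    linarith
  nlinarith
end
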